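/- Equation (15) in the proof of Proposition A.1: Let x_1, ..., x_l in R^k (l <= k) be linearly independent, let c be a nonzero vector in span(x_1, ..., x_l), set M = (1/l) * sum_{i=1}^l x_i x_i^T, fix d with M d = c, define eps_i* = sign(x_i^T d), p_i* = |x_i^T d| / sum_j |x_j^T d|, and gamma = l / sum_j |x_j^T d|, and let xi* = {(x_i, p_i*)}. Then for every e in R^k with M(xi*) e = c and every index i with p_i* > 0, one has x_i^T e = eps_i* / gamma. -/

import Mathlib

open Matrix BigOperators

/-- The information matrix of a design with points `x i` and weights `p i`. -/
noncomputable def infoMat {k l : ℕ} (x : Fin l → Fin k → ℝ) (p : Fin l → ℝ) :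
    Matrix (Fin k) (Fin k) ℝ :=
  ∑ i, p i • vecMulVec (x i) (x i)

/-- The optimal sign `ε_i* = sign(x_iᵀ d)`, where `d` solves `M d = c`. -/
noncomputable def epsStar {k l : ℕ} (x : Fin l → Fin k → ℝ) (d : Fin k → ℝ) (i : Fin l) : ℝ :=
  Real.sign (x i ⬝ᵥ d)

/-- The optimal weight `p_i* = |x_iᵀ d| / ∑ j |x_jᵀ d|`, where `d` solves `M d = c`. -/
noncomputable def pStar {k l : ℕ} (x : Fin l → Fin k → ℝ) (d : Fin k → ℝ) (i : Fin l) : ℝ :=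
  |x i ⬝ᵥ d| / ∑ j, |x j ⬝ᵥ d|

theorem infoMat_mulVec {k l : ℕ} (x : Fin l → Fin k → ℝ) (p : Fin l → ℝ) (v : Fin k → ℝ) :
    infoMat x p *ᵥ v = ∑ i, (p i * (x i ⬝ᵥ v)) • x i := by
  simp [infoMat, sum_mulVec, smul_mulVec, vecMulVec_mulVec, smul_smul]

/-- For linearly independent points, the information matrix times a vector determines the
weighted inner products of the points with that vector. -/
theorem mul_dotProduct_eq_of_infoMat_mulVec_eq {k l : ℕ} {x : Fin l → Fin k → ℝ}
    (hx : LinearIndependent ℝ x) {p q : Fin l → ℝ} {v w : Fin k → ℝ}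
    (h : infoMat x p *ᵥ v = infoMat x q *ᵥ w) (i : Fin l) :
    p i * (x i ⬝ᵥ v) = q i * (x i ⬝ᵥ w) := by
  rw [infoMat_mulVec, infoMat_mulVec] at h
  refine sub_eq_zero.mp <| Fintype.linearIndependent_iff.mp hx
    (fun j => p j * (x j ⬝ᵥ v) - q j * (x j ⬝ᵥ w)) ?_ i
  simp only [sub_smul, Finset.sum_sub_distrib, h, sub_self]

/-- Equation (15) in the proof of Proposition A.1: for every `e` with
`M(ξ*) e = c` and every `i` with `p_i* > 0`, one has `x_iᵀ e = ε_i*/γ`,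
where `γ = l / ∑ j |x_jᵀ d|`. -/
theorem eq15_xiStar {k l : ℕ} (hk : 1 ≤ k) (hl : l ≤ k)
    (x : Fin l → Fin k → ℝ) (hxLI : LinearIndependent ℝ x)
    (c : Fin k → ℝ) (hc : c ≠ 0) (hcspan : c ∈ Submodule.span ℝ (Set.range x))
    (M : Matrix (Fin k) (Fin k) ℝ) (hM : M = (l : ℝ)⁻¹ • ∑ i, vecMulVec (x i) (x i))
    (d : Fin k → ℝ) (hd : M *ᵥ d = c)
    (γ : ℝ) (hγ : γ = (l : ℝ) / ∑ j, |x j ⬝ᵥ d|) :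
    ∀ e : Fin k → ℝ, (infoMat x (pStar x d)) *ᵥ e = c →
      ∀ i, 0 < pStar x d i → x i ⬝ᵥ e = epsStar x d i / γ := by
  intro e he i hi
  have hM' : M = infoMat x fun _ => (l : ℝ)⁻¹ := by
    rw [hM, infoMat, Finset.smul_sum]
  have key := mul_dotProduct_eq_of_infoMat_mulVec_eq hxLI (he.trans (hM' ▸ hd.symm)) i
  unfold pStar at hi key
  have hl0 : (l : ℝ) ≠ 0 := by
    have := i.pos
    positivity
  have hS : ∑ j, |x j ⬝ᵥ d| ≠ 0 := fun h => by simp [h] at hi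
  have ha : x i ⬝ᵥ d ≠ 0 := fun h => by simp [h] at hi
  rw [hγ, epsStar]
  field_simp at key ⊢
  rcases ha.lt_or_gt with ha' | ha'
  · rw [Real.sign_of_neg ha']
    rw [abs_of_neg ha'] at key
    apply mul_left_cancel₀ ha
    linarith
  · rw [Real.sign_of_pos ha']
    rw [abs_of_pos ha'] at key
    apply mul_left_cancel₀ ha
    linarith
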